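/- arXiv:0911.0154 — 2 statements merged into one kernel-verified Lean document; each statement's English description precedes it below -/
import Mathlib

section
/- Let (X,d) be a locally compact, non-compact metric space that is a J-space, let G be its group of surjective isometries with the topology of pointwise convergence, and let P be the unique non-compact pseudo-component of X. Then P is G-invariant and the action of G on P is proper, i.e. the map G × P → P × P, (g,x) ↦ (g·x, x), is a proper map. -/
open Metric Set Filter Topology
open scoped ENNReal

/-- The radius of compactness of a point `x` in a metric space: the supremum of all
radii `r > 0` such that the closed closure of the open ball `B(x,r)` is compact. -/
noncomputable def radiusOfCompactness {X : Type*} [MetricSpace X] (x : X) : ℝ≥0∞ :=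
  ⨆ (r : ℝ) (_ : 0 < r ∧ IsCompact (closure (Metric.ball x r))), ENNReal.ofReal r

/-- The relation `x R y ↔ d(x,y) < ρ(x)`. -/
def pcRel {X : Type*} [MetricSpace X] (x y : X) : Prop :=
  ENNReal.ofReal (dist x y) < radiusOfCompactness x

/-- The equivalence relation `E`: `x E y` iff `x = y` or (`x R* y` and `y R* x`), where
`R*` is the transitive closure of `R`. -/
def pcEquiv {X : Type*} [MetricSpace X] (x y : X) : Prop :=
  x = y ∨ (Relation.TransGen pcRel x y ∧ Relation.TransGen pcRel y x)

/-- The pseudo-component of `x`: its `E`-equivalence class. -/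
def pseudoComponent {X : Type*} [MetricSpace X] (x : X) : Set X :=
  {y | pcEquiv x y}

/-- A topological space `X` is a J-space if whenever `A, B` are closed sets with
`A ∪ B = X` and `A ∩ B` compact, then `A` or `B` is compact. -/
def IsJSpace (X : Type*) [TopologicalSpace X] : Prop :=
  ∀ A B : Set X, IsClosed A → IsClosed B → A ∪ B = Set.univ →
    IsCompact (A ∩ B) → IsCompact A ∨ IsCompact B

/-- The topology of pointwise convergence on the group of surjective isometries of `X`. -/
noncomputable instance isomGroupTopology (X : Type*) [MetricSpace X] :
    TopologicalSpace (X ≃ᵢ X) :=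
  TopologicalSpace.induced (fun g => (g : X → X)) Pi.topologicalSpace

section PseudoComponent

variable {X : Type*} [MetricSpace X]

theorem le_radiusOfCompactness {x : X} {r : ℝ} (hr : 0 < r)
    (h : IsCompact (closure (ball x r))) : ENNReal.ofReal r ≤ radiusOfCompactness x :=
  le_iSup₂_of_le r ⟨hr, h⟩ le_rfl

theorem exists_lt_isCompact_of_pcRel {x y : X} (h : pcRel x y) :
    ∃ r, dist x y < r ∧ IsCompact (closure (ball x r)) := by
  simp only [pcRel, radiusOfCompactness, lt_iSup_iff] at h
  obtain ⟨r, ⟨hr, hc⟩, hlt⟩ := h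
  exact ⟨r, (ENNReal.ofReal_lt_ofReal_iff hr).1 hlt, hc⟩

theorem pcRel_of_dist_lt {x y : X} {r : ℝ} (h : dist x y < r)
    (hc : IsCompact (closure (ball x r))) : pcRel x y :=
  have hr : 0 < r := dist_nonneg.trans_lt h
  ((ENNReal.ofReal_lt_ofReal_iff hr).2 h).trans_le (le_radiusOfCompactness hr hc)

theorem IsometryEquiv.isCompact_closure_ball (g : X ≃ᵢ X) {x : X} {r : ℝ}
    (hc : IsCompact (closure (ball x r))) : IsCompact (closure (ball (g x) r)) := by
  have := hc.image g.continuous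
  rwa [← g.coe_toHomeomorph, g.toHomeomorph.image_closure, g.coe_toHomeomorph,
    g.image_ball] at this

theorem pcRel.map_isometryEquiv (g : X ≃ᵢ X) {x y : X} (h : pcRel x y) :
    pcRel (g x) (g y) := by
  obtain ⟨r, hr, hc⟩ := exists_lt_isCompact_of_pcRel h
  exact pcRel_of_dist_lt (by rwa [g.dist_eq]) (g.isCompact_closure_ball hc)

theorem pcEquiv.map_isometryEquiv (g : X ≃ᵢ X) {x y : X} (h : pcEquiv x y) :
    pcEquiv (g x) (g y) := by
  have key : ∀ {a b : X}, Relation.TransGen pcRel a b →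
      Relation.TransGen pcRel (g a) (g b) := fun hab =>
    hab.lift g fun _ _ => pcRel.map_isometryEquiv g
  rcases h with rfl | ⟨h₁, h₂⟩
  · exact .inl rfl
  · exact .inr ⟨key h₁, key h₂⟩

theorem pcEquiv.symm {x y : X} (h : pcEquiv x y) : pcEquiv y x := by
  rcases h with rfl | ⟨h₁, h₂⟩
  · exact .inl rfl
  · exact .inr ⟨h₂, h₁⟩

theorem pcEquiv.trans {x y z : X} (h : pcEquiv x y) (h' : pcEquiv y z) : pcEquiv x z := by
  rcases h with rfl | ⟨h₁, h₂⟩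
  · exact h'
  rcases h' with rfl | ⟨h₃, h₄⟩
  · exact .inr ⟨h₁, h₂⟩
  · exact .inr ⟨h₁.trans h₃, h₄.trans h₂⟩

theorem pseudoComponent_eq_of_mem {x y : X} (h : y ∈ pseudoComponent x) :
    pseudoComponent y = pseudoComponent x :=
  Set.ext fun _ => ⟨fun hz => pcEquiv.trans h hz, fun hz => (pcEquiv.symm h).trans hz⟩

theorem image_pseudoComponent (g : X ≃ᵢ X) (x : X) :
    g '' pseudoComponent x = pseudoComponent (g x) := by
  ext y
  constructor
  · rintro ⟨z, hz, rfl⟩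
    exact pcEquiv.map_isometryEquiv g hz
  · intro hy
    refine ⟨g.symm y, ?_, g.apply_symm_apply y⟩
    have := pcEquiv.map_isometryEquiv g.symm hy
    rwa [g.symm_apply_apply] at this

theorem eventually_pcEquiv [LocallyCompactSpace X] (x : X) : ∀ᶠ y in 𝓝 x, pcEquiv x y := by
  obtain ⟨r, hr, hc⟩ := Metric.exists_isCompact_closedBall x
  filter_upwards [ball_mem_nhds x (half_pos hr)] with y hy
  rw [mem_ball'] at hy
  refine .inr ⟨.single (pcRel_of_dist_lt (r := r) (by linarith)
    (hc.closure_of_subset ball_subset_closedBall)), .single (pcRel_of_dist_lt (r := r / 2)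
    (by rwa [dist_comm]) (hc.closure_of_subset ?_))⟩
  exact (ball_subset_ball' (by rw [dist_comm]; linarith)).trans ball_subset_closedBall

theorem isOpen_pseudoComponent [LocallyCompactSpace X] (x : X) :
    IsOpen (pseudoComponent x) :=
  isOpen_iff_mem_nhds.2 fun y hy => by
    rw [← pseudoComponent_eq_of_mem hy]
    exact eventually_pcEquiv y

theorem isClosed_pseudoComponent [LocallyCompactSpace X] (x : X) :
    IsClosed (pseudoComponent x) := by
  refine ⟨isOpen_iff_mem_nhds.2 fun y hy => ?_⟩
  filter_upwards [eventually_pcEquiv y] with z hz hxz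
  exact hy (pcEquiv.trans hxz hz.symm)

theorem IsJSpace.isCompact_compl_pseudoComponent [LocallyCompactSpace X] (hJ : IsJSpace X)
    {x : X} (hx : ¬ IsCompact (pseudoComponent x)) : IsCompact (pseudoComponent x)ᶜ :=
  (hJ _ _ (isClosed_pseudoComponent x) (isOpen_pseudoComponent x).isClosed_compl
    (Set.union_compl_self _) (by simp)).resolve_left hx

theorem IsJSpace.pseudoComponent_eq [LocallyCompactSpace X] (hJ : IsJSpace X) {x y : X}
    (hx : ¬ IsCompact (pseudoComponent x)) (hy : ¬ IsCompact (pseudoComponent y)) :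
    pseudoComponent y = pseudoComponent x := by
  by_contra hne
  refine hy ((hJ.isCompact_compl_pseudoComponent hx).of_isClosed_subset
    (isClosed_pseudoComponent y) fun z hz hz' => hne ?_)
  rw [← pseudoComponent_eq_of_mem hz, pseudoComponent_eq_of_mem hz']

theorem IsJSpace.image_pseudoComponent_eq [LocallyCompactSpace X] (hJ : IsJSpace X) {x : X}
    (hx : ¬ IsCompact (pseudoComponent x)) (g : X ≃ᵢ X) :
    g '' pseudoComponent x = pseudoComponent x := by
  rw [image_pseudoComponent]
  refine hJ.pseudoComponent_eq hx ?_
  rw [← image_pseudoComponent, ← g.coe_toHomeomorph, g.toHomeomorph.isCompact_image]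
  exact hx

theorem IsCompact.exists_tendsto_ultrafilter {ι Y : Type*} [TopologicalSpace Y] {K : Set Y}
    (hK : IsCompact K) {U : Ultrafilter ι} {f : ι → Y} (hf : ∀ᶠ i in U, f i ∈ K) :
    ∃ y, Tendsto f U (𝓝 y) := by
  obtain ⟨y, -, hy⟩ := hK.ultrafilter_le_nhds' (U.map f) hf
  exact ⟨y, hy⟩

theorem pcRel.exists_tendsto {ι : Type*} {U : Ultrafilter ι} {F : ι → X ≃ᵢ X} {x z : X}
    (h : pcRel x z) (hx : ∃ y, Tendsto (fun i => F i x) U (𝓝 y)) :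
    ∃ y, Tendsto (fun i => F i z) U (𝓝 y) := by
  obtain ⟨y, hy⟩ := hx
  obtain ⟨r, hr, hc⟩ := exists_lt_isCompact_of_pcRel h
  have hnear : ∀ᶠ i in U, dist (F i x) y < (r - dist x z) / 2 :=
    hy.eventually (ball_mem_nhds y (by linarith))
  obtain ⟨i, hi⟩ := hnear.exists
  refine ((F i).isCompact_closure_ball hc).exists_tendsto_ultrafilter ?_
  filter_upwards [hnear] with j hj
  refine subset_closure ?_
  rw [mem_ball]
  have h₁ := dist_triangle4 (F j z) (F j x) y (F i x)
  rw [(F j).dist_eq, dist_comm z x, dist_comm y] at h₁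
  linarith

theorem pcEquiv.exists_tendsto {ι : Type*} {U : Ultrafilter ι} {F : ι → X ≃ᵢ X} {x z : X}
    (h : pcEquiv x z) (hx : ∃ y, Tendsto (fun i => F i x) U (𝓝 y)) :
    ∃ y, Tendsto (fun i => F i z) U (𝓝 y) := by
  rcases h with rfl | ⟨h, -⟩
  · exact hx
  induction h with
  | single h => exact h.exists_tendsto hx
  | tail _ h ih => exact h.exists_tendsto ih

theorem IsJSpace.exists_tendsto [LocallyCompactSpace X] (hJ : IsJSpace X) {p : X}
    (hp : ¬ IsCompact (pseudoComponent p)) {ι : Type*} {U : Ultrafilter ι}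
    {F : ι → X ≃ᵢ X} {x y : X} (hxp : x ∈ pseudoComponent p)
    (hx : Tendsto (fun i => F i x) U (𝓝 y)) (z : X) :
    ∃ w, Tendsto (fun i => F i z) U (𝓝 w) := by
  by_cases hz : z ∈ pseudoComponent p
  · exact ((pcEquiv.symm hxp).trans hz).exists_tendsto ⟨y, hx⟩
  · refine (hJ.isCompact_compl_pseudoComponent hp).exists_tendsto_ultrafilter
      (.of_forall fun i hi => hz ?_)
    rw [← hJ.image_pseudoComponent_eq hp (F i)] at hi
    exact (F i).injective.mem_set_image.1 hi

theorem IsometryEquiv.tendsto_symm {ι : Type*} {l : Filter ι} {F : ι → X ≃ᵢ X} {x y : X}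
    (h : Tendsto (fun i => F i x) l (𝓝 y)) : Tendsto (fun i => (F i).symm y) l (𝓝 x) := by
  rw [tendsto_iff_dist_tendsto_zero] at h ⊢
  refine h.congr fun i => ?_
  rw [← (F i).dist_eq ((F i).symm y) x, (F i).apply_symm_apply, dist_comm]

theorem IsometryEquiv.tendsto_nhds_iff {ι : Type*} {l : Filter ι} {F : ι → X ≃ᵢ X}
    {g : X ≃ᵢ X} : Tendsto F l (𝓝 g) ↔ ∀ x, Tendsto (fun i => F i x) l (𝓝 (g x)) := by
  rw [nhds_induced, tendsto_comap_iff, tendsto_pi_nhds]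
  rfl

/-- A family of isometries converging pointwise together with the family of its inverses
converges to an isometry. -/
theorem IsometryEquiv.exists_tendsto {ι : Type*} {l : Filter ι} [l.NeBot]
    {F : ι → X ≃ᵢ X} (h : ∀ z, ∃ w, Tendsto (fun i => F i z) l (𝓝 w))
    (h' : ∀ z, ∃ w, Tendsto (fun i => (F i).symm z) l (𝓝 w)) :
    ∃ g : X ≃ᵢ X, Tendsto F l (𝓝 g) := by
  choose a ha using h
  choose b hb using h'
  have hab : ∀ z, a (b z) = z := fun z =>
    tendsto_nhds_unique (ha (b z)) (by simpa using tendsto_symm (hb z))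
  have ha_isom : Isometry a := Isometry.of_dist_eq fun x y =>
    tendsto_nhds_unique ((ha x).dist (ha y)) (by simp [IsometryEquiv.dist_eq])
  exact ⟨IsometryEquiv.mk' a b hab ha_isom, tendsto_nhds_iff.2 ha⟩

/-- If `u` converges to `x`, then evaluating isometries along `u` and evaluating them at `x`
give the same limits. -/
theorem tendsto_isometryEquiv_apply {ι : Type*} {l : Filter ι} {F : ι → X ≃ᵢ X}
    {u : ι → X} {x y : X} (hu : Tendsto u l (𝓝 x)) :
    Tendsto (fun i => F i (u i)) l (𝓝 y) ↔ Tendsto (fun i => F i x) l (𝓝 y) := by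
  have hd : Tendsto (fun i => dist (F i (u i)) (F i x)) l (𝓝 0) := by
    simpa only [IsometryEquiv.dist_eq] using tendsto_iff_dist_tendsto_zero.1 hu
  exact ⟨fun h => h.congr_dist hd, fun h => h.congr_dist (by simpa only [dist_comm] using hd)⟩

theorem continuous_isometryEquiv_apply : Continuous fun q : (X ≃ᵢ X) × X => q.1 q.2 :=
  continuous_iff_continuousAt.2 fun q =>
    (tendsto_isometryEquiv_apply (continuous_snd.tendsto q)).2
      (IsometryEquiv.tendsto_nhds_iff.1 (continuous_fst.tendsto q) q.2)

end PseudoComponent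

/-- The unique non-compact pseudo-component `P` of a locally compact,
non-compact metric J-space is invariant under every isometry, and the evaluation action
of the isometry group on `P` is proper, i.e. the map `G × P → P × P`,
`(g,x) ↦ (g·x, x)` is a proper map. -/
theorem isometryGroup_acts_properly_on_noncompact_pseudoComponent
    {X : Type*} [MetricSpace X] [LocallyCompactSpace X]
    (hnc : ¬ CompactSpace X) (hJ : IsJSpace X)
    (P : Set X) (hP : P ∈ Set.range (pseudoComponent (X := X)))
    (hPnc : ¬ IsCompact P) :
    (∀ g : X ≃ᵢ X, g '' P = P) ∧
      ∀ hinv : ∀ (g : X ≃ᵢ X) (x : X), x ∈ P → g x ∈ P,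
        IsProperMap (fun q : (X ≃ᵢ X) × P =>
          ((⟨q.1 q.2.1, hinv q.1 q.2.1 q.2.2⟩, q.2) : P × P)) := by
  obtain ⟨p, rfl⟩ := hP
  refine ⟨hJ.image_pseudoComponent_eq hPnc, fun hinv => isProperMap_iff_ultrafilter.2 ⟨?_, ?_⟩⟩
  · exact ((continuous_isometryEquiv_apply.comp
      (continuous_fst.prodMk (continuous_subtype_val.comp continuous_snd))).subtype_mk _).prodMk
      continuous_snd
  · rintro U ⟨y, x⟩ hU
    rw [nhds_prod_eq, tendsto_prod_iff'] at hU
    obtain ⟨hy, hx⟩ := hU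
    have hgx : Tendsto (fun q : (X ≃ᵢ X) × pseudoComponent p => q.1 x) U (𝓝 (y : X)) :=
      (tendsto_isometryEquiv_apply ((continuous_subtype_val.tendsto x).comp hx)).1
        ((continuous_subtype_val.tendsto y).comp hy)
    obtain ⟨g, hg⟩ := IsometryEquiv.exists_tendsto (hJ.exists_tendsto hPnc x.2 hgx)
      (hJ.exists_tendsto hPnc y.2 (IsometryEquiv.tendsto_symm hgx))
    refine ⟨(g, x), Prod.ext (Subtype.ext ?_) rfl, ?_⟩
    · exact tendsto_nhds_unique (IsometryEquiv.tendsto_nhds_iff.1 hg x) hgx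
    · rw [nhds_prod_eq]
      exact tendsto_id'.1 (hg.prodMk hx)
end

section
/- Let X be a non-compact J-space and let 𝒜 be a partition of X into non-empty closed-open sets. Then at least one member of 𝒜 is not compact; in particular, a non-compact J-space cannot be partitioned into non-empty compact closed-open sets. -/
open Set

/-- A pairwise disjoint family of non-empty open sets with compact union is finite. -/
theorem Set.PairwiseDisjoint.finite_of_isCompact_sUnion {X : Type*} [TopologicalSpace X]
    {𝒮 : Set (Set X)} (hdisj : 𝒮.PairwiseDisjoint id) (hne : ∀ A ∈ 𝒮, A.Nonempty)
    (hopen : ∀ A ∈ 𝒮, IsOpen A) (hcompact : IsCompact (⋃₀ 𝒮)) : 𝒮.Finite := by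
  obtain ⟨𝒯, h𝒯𝒮, h𝒯, hsub⟩ :=
    hcompact.elim_finite_subcover_image (c := id) hopen sUnion_eq_biUnion.subset
  refine h𝒯.subset fun A hA => ?_
  obtain ⟨x, hx⟩ := hne A hA
  obtain ⟨B, hB, hxB⟩ := mem_iUnion₂.1 (hsub (mem_sUnion_of_mem hx hA))
  rwa [hdisj.elim_set hA (h𝒯𝒮 hB) x hx hxB]

/-- Any partition of a non-compact J-space into non-empty clopen sets
contains a non-compact member; in particular a non-compact J-space cannot be partitioned
into non-empty compact clopen sets. -/
theorem clopen_partition_of_JSpace_has_noncompact_member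
    {X : Type*} [TopologicalSpace X] (hnc : ¬ CompactSpace X) (hJ : IsJSpace X)
    (𝒜 : Set (Set X))
    (hne : ∀ A ∈ 𝒜, A.Nonempty)
    (hclopen : ∀ A ∈ 𝒜, IsClopen A)
    (hdisj : 𝒜.PairwiseDisjoint id)
    (hcover : ⋃₀ 𝒜 = Set.univ) :
    ∃ A ∈ 𝒜, ¬ IsCompact A := by
  by_contra! hcompact
  have hinf : 𝒜.Infinite := fun hfin =>
    hnc ⟨hcover ▸ hfin.isCompact_sUnion hcompact⟩
  obtain ⟨𝒮, 𝒯, rfl, hST, hcard⟩ := hinf.exists_union_disjoint_cardinal_eq_of_infinite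
  have hfin : 𝒮.Finite ↔ 𝒯.Finite := by
    rw [← Cardinal.lt_aleph0_iff_set_finite, ← Cardinal.lt_aleph0_iff_set_finite, hcard]
  rw [sUnion_union] at hcover
  have hinter : Disjoint (⋃₀ 𝒮) (⋃₀ 𝒯) :=
    disjoint_sUnion_left.2 fun A hA => disjoint_sUnion_right.2 fun B hB =>
      hdisj (Or.inl hA) (Or.inr hB) (hST.ne_of_mem hA hB)
  have hcompl : IsCompl (⋃₀ 𝒮) (⋃₀ 𝒯) := ⟨hinter, codisjoint_iff.2 hcover⟩
  have hS : IsOpen (⋃₀ 𝒮) := isOpen_sUnion fun A hA => (hclopen A (Or.inl hA)).isOpen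
  have hT : IsOpen (⋃₀ 𝒯) := isOpen_sUnion fun A hA => (hclopen A (Or.inr hA)).isOpen
  have hfinite : 𝒮.Finite ∨ 𝒯.Finite :=
    (hJ (⋃₀ 𝒮) (⋃₀ 𝒯) (by rwa [← isOpen_compl_iff, hcompl.compl_eq])
      (by rwa [← isOpen_compl_iff, hcompl.symm.compl_eq]) hcover
      (by rw [hinter.inter_eq]; exact isCompact_empty)).imp
    ((hdisj.subset subset_union_left).finite_of_isCompact_sUnion
      (fun A hA => hne A (Or.inl hA)) fun A hA => (hclopen A (Or.inl hA)).isOpen)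
    ((hdisj.subset subset_union_right).finite_of_isCompact_sUnion
      (fun A hA => hne A (Or.inr hA)) fun A hA => (hclopen A (Or.inr hA)).isOpen)
  rcases hfinite with h | h
  · exact hinf (h.union (hfin.1 h))
  · exact hinf ((hfin.2 h).union h)
end
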